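/- arXiv:2512.24535 — 2 statements merged into one kernel-verified Lean document; each statement's English description precedes it below -/
import Mathlib

section
/- Let (P_n)_{n∈ℤ} be a sequence of real polynomials satisfying the Chebyshev recursion P_{n+1} = X·P_n − P_{n−1} for all n ∈ ℤ, let x₀ ∈ ℝ and let k ∈ ℤ be such that P_k(x₀) = 0. Then for every n ∈ ℤ, P_{k+n}(x₀) = P^U_n(x₀) · P_{k+1}(x₀). In particular, if additionally P_{k+1}(x₀) ≠ 0 and P_{k+N}(x₀) = 0 for some integer N, then P^U_N(x₀) = 0. -/
/-- `PU n` is the real polynomial with `PU 0 = 0`, `PU 1 = 1` and the Chebyshev recursion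
`PU (n+1) = X * PU n - PU (n-1)`; equivalently `PU n x = U (n-1) (x/2)` where `U` is
Mathlib's integer-indexed Chebyshev polynomial of the second kind. -/
noncomputable def PU (n : ℤ) : Polynomial ℝ :=
  (Polynomial.Chebyshev.U ℝ (n - 1)).comp (Polynomial.C (1 / 2) * Polynomial.X)

theorem PU_eval_rec (x : ℝ) (n : ℤ) :
    (PU (n + 1)).eval x = x * (PU n).eval x - (PU (n - 1)).eval x := by
  have h := Polynomial.Chebyshev.U_add_two ℝ (n - 2)
  have h1 : n - 2 + 2 = n + 1 - 1 := by ring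
  have h2 : n - 2 + 1 = n - 1 := by ring
  have h3 : n - 2 = n - 1 - 1 := by ring
  rw [h1, h2, h3] at h
  unfold PU
  rw [h]
  simp only [Polynomial.eval_comp, Polynomial.eval_sub, Polynomial.eval_mul, Polynomial.eval_C,
    Polynomial.eval_X, Polynomial.eval_ofNat]
  ring

theorem stmt1 (P : ℤ → Polynomial ℝ)
    (hP : ∀ n : ℤ, P (n + 1) = Polynomial.X * P n - P (n - 1))
    (x₀ : ℝ) (k : ℤ) (hk : (P k).eval x₀ = 0) :
    (∀ n : ℤ, (P (k + n)).eval x₀ = (PU n).eval x₀ * (P (k + 1)).eval x₀) ∧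
      ((P (k + 1)).eval x₀ ≠ 0 →
        ∀ N : ℤ, (P (k + N)).eval x₀ = 0 → (PU N).eval x₀ = 0) := by
  have hR : ∀ n : ℤ, (P (k + (n + 1))).eval x₀
      = x₀ * (P (k + n)).eval x₀ - (P (k + (n - 1))).eval x₀ := by
    intro n
    rw [← add_assoc, hP (k + n), ← add_sub_assoc]
    simp
  have key : ∀ n : ℤ, (P (k + n)).eval x₀ = (PU n).eval x₀ * (P (k + 1)).eval x₀ ∧
      (P (k + (n + 1))).eval x₀ = (PU (n + 1)).eval x₀ * (P (k + 1)).eval x₀ := by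
    intro n
    induction n using Int.induction_on with
    | zero => simp [PU, hk]
    | succ i ih =>
      refine ⟨ih.2, ?_⟩
      have h1 := hR ((i : ℤ) + 1)
      have h2 := PU_eval_rec x₀ ((i : ℤ) + 1)
      rw [add_sub_cancel_right] at h1 h2
      rw [h1, h2, ih.1, ih.2]
      ring
    | pred i ih =>
      have h1 := hR (-(i : ℤ))
      have h2 := PU_eval_rec x₀ (-(i : ℤ))
      rw [sub_add_cancel]
      refine ⟨?_, ih.1⟩
      rw [ih.1, ih.2, h2] at h1
      linarith
  refine ⟨fun n => (key n).1, fun h N hN => ?_⟩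
  rw [(key N).1] at hN
  exact (mul_eq_zero.mp hN).resolve_right h
end

section
/- For every integer l, every integer k ≥ 0, and every integer r with 1 ≤ r ≤ k+1: R^{(l)}_{k+2}(2·cos(r·π/(k+2))) = (−1)^r · (l+2) · (2·cos(r·π/(k+2)) + 2l); moreover R^{(l)}_{m}(2) = 2·(l+1)·(l+2) for every integer m ≥ 0. -/
/-- `Rseq l` is the Chebyshev series of real polynomials with initial values
`R 0 = (l+2)(X + 2l)` and `R 1 = (X + (l-1))(X + 2(l+1))` and recursion
`R (m+2) = X * R (m+1) - R m`; `Rseq l (k+2)` corresponds to the paper's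
`P^{(l+2)}_{l+4+k}`. -/
noncomputable def Rseq (l : ℤ) : ℕ → Polynomial ℝ
  | 0 => Polynomial.C ((l : ℝ) + 2) * (Polynomial.X + Polynomial.C (2 * (l : ℝ)))
  | 1 => (Polynomial.X + Polynomial.C ((l : ℝ) - 1)) *
      (Polynomial.X + Polynomial.C (2 * ((l : ℝ) + 1)))
  | (m + 2) => Polynomial.X * Rseq l (m + 1) - Rseq l m

theorem Rseq_sin (l : ℤ) (t : ℝ) (m : ℕ) :
    Real.sin t * (Rseq l m).eval (2 * Real.cos t) =
      Real.sin (m * t) * (Rseq l 1).eval (2 * Real.cos t) -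
        Real.sin (m * t - t) * (Rseq l 0).eval (2 * Real.cos t) := by
  induction m using Nat.twoStepInduction with
  | zero => simp
  | one => simp
  | more m h0 h1 =>
    have e : (Rseq l (m + 2)).eval (2 * Real.cos t) =
        2 * Real.cos t * (Rseq l (m + 1)).eval (2 * Real.cos t) -
          (Rseq l m).eval (2 * Real.cos t) := by
      rw [Rseq]; simp
    have a1 : Real.sin (((m + 2 : ℕ) : ℝ) * t) =
        2 * Real.cos t * Real.sin (((m + 1 : ℕ) : ℝ) * t) - Real.sin (m * t) := by
      have u : ((m + 2 : ℕ) : ℝ) * t = ((m + 1 : ℕ) : ℝ) * t + t := by push_cast; ring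
      have v : (m : ℝ) * t = ((m + 1 : ℕ) : ℝ) * t - t := by push_cast; ring
      rw [u, v, Real.sin_add, Real.sin_sub]; ring
    have a2 : Real.sin (((m + 2 : ℕ) : ℝ) * t - t) =
        2 * Real.cos t * Real.sin (((m + 1 : ℕ) : ℝ) * t - t) - Real.sin (m * t - t) := by
      have u : ((m + 2 : ℕ) : ℝ) * t - t = m * t + t := by push_cast; ring
      have v : ((m + 1 : ℕ) : ℝ) * t - t = m * t := by push_cast; ring
      rw [u, v, Real.sin_add, Real.sin_sub]; ring
    rw [e, a1, a2]
    linear_combination 2 * Real.cos t * h1 - h0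

/-- for every integer `l`, every `k ≥ 0` and `1 ≤ r ≤ k+1`,
`Rseq l (k+2)` evaluated at `x_r = 2 cos (r π / (k+2))` equals
`(-1)^r (l+2)(x_r + 2l)`; moreover `Rseq l m` evaluated at `2` equals
`2(l+1)(l+2)` for every `m ≥ 0`. -/
theorem stmt17 (l : ℤ) :
    (∀ k r : ℕ, 1 ≤ r → r ≤ k + 1 →
      (Rseq l (k + 2)).eval (2 * Real.cos (r * Real.pi / (k + 2))) =
        (-1 : ℝ) ^ r * ((l : ℝ) + 2) *
          (2 * Real.cos (r * Real.pi / (k + 2)) + 2 * (l : ℝ))) ∧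
    (∀ m : ℕ, (Rseq l m).eval 2 = 2 * ((l : ℝ) + 1) * ((l : ℝ) + 2)) := by
  constructor
  · intro k r h1 h2
    have hk : (0 : ℝ) < (k : ℝ) + 2 := by positivity
    have hr : (0 : ℝ) < r := by exact_mod_cast h1
    have hr2 : (r : ℝ) < (k : ℝ) + 2 := by exact_mod_cast (by omega : r < k + 2)
    have key := Rseq_sin l (r * Real.pi / (k + 2)) (k + 2)
    have hm : ((k + 2 : ℕ) : ℝ) * (r * Real.pi / (k + 2)) = r * Real.pi := by
      push_cast; field_simp
    have hs : 0 < Real.sin (r * Real.pi / (k + 2)) := by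
      apply Real.sin_pos_of_pos_of_lt_pi
      · positivity
      · rw [div_lt_iff₀ hk]
        nlinarith [Real.pi_pos]
    rw [hm, Real.sin_sub, Real.sin_nat_mul_pi, Real.cos_nat_mul_pi] at key
    have e0 : (Rseq l 0).eval (2 * Real.cos (r * Real.pi / (k + 2))) =
        ((l : ℝ) + 2) * (2 * Real.cos (r * Real.pi / (k + 2)) + 2 * (l : ℝ)) := by
      simp [Rseq]
    rw [e0] at key
    apply mul_left_cancel₀ hs.ne'
    rw [key]; ring
  · intro m
    induction m using Nat.twoStepInduction with
    | zero => simp [Rseq]; ring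
    | one => simp [Rseq]; ring
    | more m h0 h1 =>
      rw [Rseq]
      simp only [Polynomial.eval_sub, Polynomial.eval_mul, Polynomial.eval_X, h0, h1]
      ring
end
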